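/- Let f : [a,b] → ℝ be absolutely continuous with f' essentially bounded, let w : [a,b] → [0,∞) be integrable, and suppose m(a,(a+b)/2) > 0, m((a+b)/2,b) > 0, and w(u) ≤ w((a+b)/2) for almost every u ∈ [a,b]. Then |f((a+b)/2) − (1/2)·[M(f,w;a,(a+b)/2) + M(f,w;(a+b)/2,b)]| ≤ (1/4)·[1/m(a,(a+b)/2) + 1/m((a+b)/2,b)]·((b−a)/2)²·w((a+b)/2)·‖f'‖_∞. -/

import Mathlib

open MeasureTheory intervalIntegral

/-- A weighted mean of a function that is `M`-Lipschitz about `x` deviates from the value at `x` by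
at most `M * W` times the first absolute moment about `x` over the total weight, if `w ≤ W`. -/
lemma abs_sub_weighted_mean_le {c d x M W : ℝ} {f w : ℝ → ℝ} (hcd : c ≤ d)
    (hw : IntervalIntegrable w volume c d) (hw_nonneg : ∀ t ∈ Set.Icc c d, 0 ≤ w t)
    (hf : ContinuousOn f (Set.Icc c d)) (hM : 0 ≤ M)
    (hfx : ∀ t ∈ Set.Icc c d, |f x - f t| ≤ M * |x - t|)
    (hW : ∀ᵐ u ∂(volume.restrict (Set.Icc c d)), w u ≤ W) (hm : 0 < ∫ t in c..d, w t) :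
    |f x - (∫ t in c..d, f t * w t) / ∫ t in c..d, w t| ≤
      M * W * (∫ t in c..d, |x - t|) / ∫ t in c..d, w t := by
  have hfw : IntervalIntegrable (fun t => f t * w t) volume c d :=
    hw.continuousOn_mul (by rwa [Set.uIcc_of_le hcd])
  have hdev : f x - (∫ t in c..d, f t * w t) / (∫ t in c..d, w t) =
      (∫ t in c..d, (f x - f t) * w t) / ∫ t in c..d, w t := by
    simp_rw [sub_mul]
    rw [intervalIntegral.integral_sub (hw.const_mul _) hfw, intervalIntegral.integral_const_mul]
    field_simp
  rw [hdev, abs_div, abs_of_pos hm]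
  refine div_le_div_of_nonneg_right ?_ hm.le
  have hbound : IntervalIntegrable (fun t => M * W * |x - t|) volume c d :=
    Continuous.intervalIntegrable (by fun_prop) _ _
  rw [← intervalIntegral.integral_const_mul, ← Real.norm_eq_abs]
  refine intervalIntegral.norm_integral_le_of_norm_le hcd ?_ hbound
  rw [ae_restrict_iff' measurableSet_Icc] at hW
  filter_upwards [hW] with t ht htm
  have htI := Set.Ioc_subset_Icc_self htm
  rw [Real.norm_eq_abs, abs_mul, abs_of_nonneg (hw_nonneg t htI)]
  calc |f x - f t| * w t ≤ (M * |x - t|) * W :=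
        mul_le_mul (hfx t htI) (ht htI) (hw_nonneg t htI) (by positivity)
    _ = M * W * |x - t| := by ring

/-- A primitive of a function that is essentially bounded by `M` is `M`-Lipschitz. -/
lemma abs_sub_le_of_eq_add_integral {a b M : ℝ} {f f' : ℝ → ℝ}
    (hf' : IntervalIntegrable f' volume a b)
    (hftc : ∀ y ∈ Set.Icc a b, f y = f a + ∫ t in a..y, f' t)
    (hM : ∀ᵐ t ∂(volume.restrict (Set.Icc a b)), |f' t| ≤ M)
    {x y : ℝ} (hx : x ∈ Set.Icc a b) (hy : y ∈ Set.Icc a b) :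
    |f x - f y| ≤ M * |x - y| := by
  have hint : ∀ z ∈ Set.Icc a b, IntervalIntegrable f' volume a z := fun z hz =>
    hf'.mono_set (Set.uIcc_subset_uIcc Set.left_mem_uIcc (Set.Icc_subset_uIcc hz))
  rw [hftc x hx, hftc y hy, add_sub_add_left_eq_sub,
    integral_interval_sub_left (hint x hx) (hint y hy)]
  rw [← Real.norm_eq_abs]
  refine intervalIntegral.norm_integral_le_of_norm_le_const_ae ?_
  rw [ae_restrict_iff' measurableSet_Icc] at hM
  filter_upwards [hM] with t ht htm
  exact ht (Set.uIcc_subset_Icc hy hx (Set.uIoc_subset_uIcc htm))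

/-- The first absolute moment of an interval about its right endpoint. -/
lemma integral_abs_right_sub {c d : ℝ} (hcd : c ≤ d) :
    ∫ t in c..d, |d - t| = (d - c) ^ 2 / 2 := by
  have h : ∫ t in c..d, |d - t| = ∫ t in c..d, (d - t) :=
    integral_congr fun t ht => by
      rw [Set.uIcc_of_le hcd] at ht
      exact abs_of_nonneg (sub_nonneg.2 ht.2)
  rw [h, intervalIntegral.integral_sub (by simp) (by simp),
    intervalIntegral.integral_const, integral_id, smul_eq_mul]
  ring

/-- The first absolute moment of an interval about its left endpoint. -/
lemma integral_abs_left_sub {c d : ℝ} (hcd : c ≤ d) :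
    ∫ t in c..d, |c - t| = (d - c) ^ 2 / 2 := by
  have h : ∫ t in c..d, |c - t| = ∫ t in c..d, (t - c) :=
    integral_congr fun t ht => by
      rw [Set.uIcc_of_le hcd] at ht
      exact (abs_sub_comm c t).trans (abs_of_nonneg (sub_nonneg.2 ht.1))
  rw [h, intervalIntegral.integral_sub (by simp) (by simp),
    intervalIntegral.integral_const, integral_id, smul_eq_mul]
  ring

/-- **Corollary 3, `L_∞` case** (midpoint, `α = β`). If `f` is absolutely continuous on
`[a,b]` (expressed via the fundamental theorem of calculus with integrable density `f'`),
`f'` is essentially bounded by `M` on `[a,b]`, `w ≥ 0` is an integrable weight, and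
`m(a,(a+b)/2) > 0`, `m((a+b)/2,b) > 0`, `w(u) ≤ w((a+b)/2)` for a.e. `u ∈ [a,b]`, then
`|f((a+b)/2) − (1/2)·(M(f,w;a,(a+b)/2) + M(f,w;(a+b)/2,b))|
  ≤ (1/4)·(1/m(a,(a+b)/2) + 1/m((a+b)/2,b))·((b−a)/2)²·w((a+b)/2)·M`. -/
theorem weighted_ostrowski_midpoint_symmetric_Linfty (a b : ℝ) (hab : a < b)
    (f f' w : ℝ → ℝ) (M : ℝ)
    (hw_int : IntervalIntegrable w volume a b)
    (hw_nonneg : ∀ t ∈ Set.Icc a b, 0 ≤ w t)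
    (hf'int : IntervalIntegrable f' volume a b)
    (hftc : ∀ y ∈ Set.Icc a b, f y = f a + ∫ t in a..y, f' t)
    (hM : ∀ᵐ t ∂(volume.restrict (Set.Icc a b)), |f' t| ≤ M)
    (hmax : 0 < ∫ t in a..((a + b) / 2), w t) (hmxb : 0 < ∫ t in ((a + b) / 2)..b, w t)
    (hw_le : ∀ᵐ u ∂(volume.restrict (Set.Icc a b)), w u ≤ w ((a + b) / 2)) :
    |f ((a + b) / 2) - (1 / 2) *
        ((∫ t in a..((a + b) / 2), f t * w t) / (∫ t in a..((a + b) / 2), w t) +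
          (∫ t in ((a + b) / 2)..b, f t * w t) / (∫ t in ((a + b) / 2)..b, w t))| ≤
      (1 / 4) *
        (1 / (∫ t in a..((a + b) / 2), w t) + 1 / (∫ t in ((a + b) / 2)..b, w t)) *
        ((b - a) / 2) ^ 2 * w ((a + b) / 2) * M := by
  have hlip : ∀ x ∈ Set.Icc a b, ∀ y ∈ Set.Icc a b, |f x - f y| ≤ M * |x - y| :=
    fun x hx y hy => abs_sub_le_of_eq_add_integral hf'int hftc hM hx hy
  have hM0 : 0 ≤ M := by
    have h := (abs_nonneg _).trans
      (hlip a (Set.left_mem_Icc.2 hab.le) b (Set.right_mem_Icc.2 hab.le))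
    exact nonneg_of_mul_nonneg_left h (abs_pos.2 (sub_ne_zero.2 hab.ne))
  have hcont : ContinuousOn f (Set.Icc a b) :=
    (LipschitzOnWith.of_dist_le_mul (K := ⟨M, hM0⟩) fun x hx y hy => hlip x hx y hy).continuousOn
  set x := (a + b) / 2 with hx
  have hax : a ≤ x := by linarith
  have hxb : x ≤ b := by linarith
  have hsubl : Set.Icc a x ⊆ Set.Icc a b := Set.Icc_subset_Icc_right hxb
  have hsubr : Set.Icc x b ⊆ Set.Icc a b := Set.Icc_subset_Icc_left hax
  have hleft := abs_sub_weighted_mean_le hax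
    (hw_int.mono_set (by rwa [Set.uIcc_of_le hax, Set.uIcc_of_le hab.le]))
    (fun t ht => hw_nonneg t (hsubl ht)) (hcont.mono hsubl) hM0
    (fun t ht => hlip x ⟨hax, hxb⟩ t (hsubl ht))
    (ae_restrict_of_ae_restrict_of_subset hsubl hw_le) hmax
  have hright := abs_sub_weighted_mean_le hxb
    (hw_int.mono_set (by rwa [Set.uIcc_of_le hxb, Set.uIcc_of_le hab.le]))
    (fun t ht => hw_nonneg t (hsubr ht)) (hcont.mono hsubr) hM0
    (fun t ht => hlip x ⟨hax, hxb⟩ t (hsubr ht))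
    (ae_restrict_of_ae_restrict_of_subset hsubr hw_le) hmxb
  rw [integral_abs_right_sub hax, show x - a = (b - a) / 2 by rw [hx]; ring] at hleft
  rw [integral_abs_left_sub hxb, show b - x = (b - a) / 2 by rw [hx]; ring] at hright
  rw [abs_le] at hleft hright ⊢
  simp only [div_eq_mul_inv] at hleft hright ⊢
  constructor <;> linarith [hleft.1, hleft.2, hright.1, hright.2]
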